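/- arXiv:math/0410410 — 3 statements merged into one kernel-verified Lean document; each statement's English description precedes it below -/
import Mathlib

section
/- Let G be a finite connected simple graph, let W be a positive weight function on G (W(q) > 0 for every vertex q), and let D be a distribution on G whose set N of distribution nodes relative to W (vertices q with D(q) > W(q)) is nonempty. If V_N(D) ≥ max_{d ∈ N} V_{{d}}(W), then D covers W. -/
/-- A single pebbling move on graph `G`: remove two pebbles from a vertex `p`
(which must carry at least two pebbles) and add one pebble to an adjacent vertex `q`. -/
def PebblingMove {V : Type*} (G : SimpleGraph V) (D D' : V → ℕ) : Prop :=
  ∃ p q : V, G.Adj p q ∧ 2 ≤ D p ∧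
    D' p = D p - 2 ∧ D' q = D q + 1 ∧ ∀ s : V, s ≠ p → s ≠ q → D' s = D s

/-- `D'` is derivable from `D` by a (possibly empty) finite sequence of pebbling moves. -/
def Derivable {V : Type*} (G : SimpleGraph V) (D D' : V → ℕ) : Prop :=
  Relation.ReflTransGen (PebblingMove G) D D'

/-- `D` covers `W` if some distribution derivable from `D` contains `W`. -/
def Covers {V : Type*} (G : SimpleGraph V) (D W : V → ℕ) : Prop :=
  ∃ D' : V → ℕ, Derivable G D D' ∧ ∀ q : V, W q ≤ D' q

/-- The standard value `V_S(D) = ∑_q D(q) · 2^{d(q,S)}`, where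
`d(q,S) = min_{r ∈ S} d(q,r)`. -/
noncomputable def stdVal {V : Type*} [Fintype V] (G : SimpleGraph V) (S : Set V)
    (D : V → ℕ) : ℕ :=
  ∑ q : V, D q * 2 ^ sInf {d : ℕ | ∃ r ∈ S, G.dist q r = d}

/-- The stacking number `SN_W(G) = max_v ∑_u W(u) · 2^{d(u,v)}`. -/
noncomputable def SN {V : Type*} [Fintype V] (G : SimpleGraph V) (W : V → ℕ) : ℕ :=
  Finset.univ.sup fun v : V => ∑ u : V, W u * 2 ^ G.dist u v

theorem PebblingMove.of_adj {V : Type*} [DecidableEq V] {G : SimpleGraph V} {D : V → ℕ} {p q : V}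
    (h : G.Adj p q) (hp : 2 ≤ D p) :
    ∃ D', PebblingMove G D D' ∧ D' + Pi.single p 2 = D + Pi.single q 1 := by
  refine ⟨D - Pi.single p 2 + Pi.single q 1,
    ⟨p, q, h, hp, by simp [h.ne], by simp [h.ne'], fun s hs ht => by simp [hs, ht]⟩, ?_⟩
  funext v
  by_cases hv : v = p
  · subst hv
    simp [h.ne, hp]
  · simp [hv]

/-- Pushing one pebble along a path, with every inner vertex contributing one of its own. -/
theorem exists_derivable_along_path {V : Type*} [DecidableEq V] {G : SimpleGraph V} {D : V → ℕ}
    (x : ℕ → V) (n : ℕ) (hadj : ∀ i ≤ n, G.Adj (x i) (x (i + 1)))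
    (hinj : Set.InjOn x (Set.Iic n)) (h0 : 2 ≤ D (x 0))
    (hinner : ∀ i < n, 1 ≤ D (x (i + 1))) :
    ∃ D', Derivable G D D' ∧
      D' + Pi.single (x 0) 2 + ∑ i ∈ Finset.range n, Pi.single (x (i + 1)) 1
        = D + Pi.single (x (n + 1)) 1 := by
  induction n with
  | zero =>
    obtain ⟨D', hD', h⟩ := PebblingMove.of_adj (hadj 0 le_rfl) h0
    exact ⟨D', .single hD', by simpa using h⟩
  | succ n ih =>
    obtain ⟨E, hE, hEq⟩ := ih (fun i hi => hadj i (by omega))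
      (hinj.mono (Set.Iic_subset_Iic.2 n.le_succ)) (fun i hi => hinner i (by omega))
    have hne : ∀ i ≤ n, x (n + 1) ≠ x i := fun i hi h => by
      have := hinj (Set.mem_Iic.2 le_rfl) (Set.mem_Iic.2 (by omega)) h
      omega
    have hval : E (x (n + 1)) = D (x (n + 1)) + 1 := by
      have h := congrFun hEq (x (n + 1))
      have hs : ∑ i ∈ Finset.range n,
          (Pi.single (x (i + 1)) 1 : V → ℕ) (x (n + 1)) = 0 :=
        Finset.sum_eq_zero fun i hi =>
          Pi.single_eq_of_ne (hne _ (by have := Finset.mem_range.1 hi; omega)) _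
      simpa [Finset.sum_apply, hs, Pi.single_eq_of_ne (hne 0 (by omega))] using h
    have hD := hinner n (by omega)
    obtain ⟨D', hD', h⟩ := PebblingMove.of_adj (D := E) (hadj (n + 1) le_rfl) (by omega)
    refine ⟨D', hE.tail hD', ?_⟩
    rw [Finset.sum_range_succ]
    funext v
    have h1 := congrFun h v
    have h2 := congrFun hEq v
    have h3 : (Pi.single (x (n + 1)) 2 : V → ℕ) v = 2 * (Pi.single (x (n + 1)) 1 : V → ℕ) v := by
      by_cases hv : v = x (n + 1)
      · subst hv; simp
      · simp [hv]
    simp only [Pi.add_apply] at h1 h2 ⊢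
    omega

theorem stdVal_mono_of_subset {V : Type*} [Fintype V] (G : SimpleGraph V) {S T : Set V}
    (hS : S.Nonempty) (hST : S ⊆ T) (D : V → ℕ) : stdVal G T D ≤ stdVal G S D := by
  refine Finset.sum_le_sum fun q _ => Nat.mul_le_mul_left _ (Nat.pow_le_pow_right two_pos ?_)
  obtain ⟨r, hr⟩ := hS
  obtain ⟨s, hs, h⟩ := Nat.sInf_mem (s := {d | ∃ r ∈ S, G.dist q r = d}) ⟨_, r, hr, rfl⟩
  exact Nat.sInf_le ⟨s, hST hs, h⟩

theorem stdVal_add {V : Type*} [Fintype V] (G : SimpleGraph V) (S : Set V) (D E : V → ℕ) :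
    stdVal G S (D + E) = stdVal G S D + stdVal G S E := by
  simp [stdVal, add_mul, Finset.sum_add_distrib]

theorem stdVal_sum {V ι : Type*} [Fintype V] (G : SimpleGraph V) (S : Set V) (s : Finset ι)
    (D : ι → V → ℕ) : stdVal G S (∑ i ∈ s, D i) = ∑ i ∈ s, stdVal G S (D i) := by
  simp only [stdVal, Finset.sum_apply, Finset.sum_mul]
  exact Finset.sum_comm

theorem stdVal_single {V : Type*} [Fintype V] [DecidableEq V] (G : SimpleGraph V) (S : Set V)
    (v : V) (n : ℕ) :
    stdVal G S (Pi.single v n) = n * 2 ^ sInf {d : ℕ | ∃ r ∈ S, G.dist v r = d} := by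
  rw [stdVal, Finset.sum_eq_single v] <;> simp +contextual

theorem eq_of_le_of_stdVal_le {V : Type*} [Fintype V] (G : SimpleGraph V) (S : Set V)
    {D W : V → ℕ} (hle : D ≤ W) (h : stdVal G S W ≤ stdVal G S D) : D = W := by
  have hterm : ∀ q ∈ Finset.univ, D q * 2 ^ sInf {d : ℕ | ∃ r ∈ S, G.dist q r = d}
      ≤ W q * 2 ^ sInf {d : ℕ | ∃ r ∈ S, G.dist q r = d} :=
    fun q _ => Nat.mul_le_mul_right _ (hle q)
  funext q
  exact Nat.eq_of_mul_eq_mul_right (by positivity)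
    ((Finset.sum_eq_sum_iff_of_le hterm).1 (le_antisymm (Finset.sum_le_sum hterm) h) q
      (Finset.mem_univ q))

/-- If some distribution node `f` and some deficient vertex `t` exist, then a closest such pair
allows a sequence of moves that preserves the standard value, creates no distribution node and
destroys none other than `f`. -/
theorem exists_derivable_stdVal_eq {V : Type*} [Fintype V] {G : SimpleGraph V}
    (hG : G.Connected) {W : V → ℕ} (hW : ∀ q : V, 0 < W q) {D : V → ℕ}
    (hN : ∃ f, W f < D f) (ht : ∃ t, D t < W t) :
    ∃ f D', Derivable G D D' ∧ W f < D f ∧ ∑ v, D' v < ∑ v, D v ∧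
      stdVal G {q | W q < D q} D' = stdVal G {q | W q < D q} D ∧
      (∀ v, W v < D' v → W v < D v) ∧ ∀ v ≠ f, W v < D v → W v < D' v := by
  classical
  have hex : ∃ m f t, W f < D f ∧ D t < W t ∧ G.dist f t = m := by
    obtain ⟨f, hf⟩ := hN
    obtain ⟨t, ht⟩ := ht
    exact ⟨_, f, t, hf, ht, rfl⟩
  obtain ⟨f, t, hf, ht, hd⟩ := Nat.find_spec hex
  have hmin : ∀ f' t', W f' < D f' → D t' < W t' → G.dist f t ≤ G.dist f' t' :=
    fun f' t' hf' ht' => hd ▸ Nat.find_min' hex ⟨f', t', hf', ht', rfl⟩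
  have hne : f ≠ t := fun h => by subst h; omega
  obtain ⟨p, hp, hlen⟩ := hG.exists_path_of_dist f t
  obtain ⟨n, hn⟩ : ∃ n, p.length = n + 1 :=
    Nat.exists_eq_succ_of_ne_zero (by rw [hlen]; exact (hG.pos_dist_of_ne hne).ne')
  have hx0 : p.getVert 0 = f := p.getVert_zero
  have hxn : p.getVert (n + 1) = t := hn ▸ p.getVert_length
  have hfrom : ∀ i ≤ n + 1, G.dist (p.getVert i) f ≤ i := fun i hi => by
    rw [SimpleGraph.dist_comm]
    exact (SimpleGraph.dist_le (p.take i)).trans (by simp)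
  have hto : ∀ i ≤ n + 1, G.dist (p.getVert i) t ≤ n + 1 - i := fun i hi =>
    (SimpleGraph.dist_le (p.drop i)).trans (by simp [hn])
  have hfar : ∀ i ≤ n + 1, ∀ r, W r < D r → i ≤ G.dist (p.getVert i) r := fun i hi r hr => by
    have h1 := hmin r t hr ht
    have h2 := hG.dist_triangle (u := r) (v := p.getVert i) (w := t)
    have h3 := hto i hi
    rw [G.dist_comm (u := r) (v := p.getVert i)] at h2
    omega
  have hdist : ∀ i ≤ n + 1,
      sInf {d : ℕ | ∃ r ∈ {q | W q < D q}, G.dist (p.getVert i) r = d} = i := fun i hi => by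
    refine le_antisymm (le_trans (Nat.sInf_le ⟨f, hf, rfl⟩) (hfrom i hi)) ?_
    refine le_csInf ⟨_, f, hf, rfl⟩ ?_
    rintro _ ⟨r, hr, rfl⟩
    exact hfar i hi r hr
  have hnot_node : ∀ i ≤ n, D (p.getVert (i + 1)) ≤ W (p.getVert (i + 1)) := fun i hi => by
    by_contra! h
    have := hfar (i + 1) (by omega) _ h
    simp at this
  have hinner : ∀ i < n, 1 ≤ D (p.getVert (i + 1)) := fun i hi => by
    refine (hW (p.getVert (i + 1))).trans_le ?_
    by_contra! h
    have h1 := hmin f _ hf h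
    have h2 := hfrom (i + 1) (by omega)
    rw [SimpleGraph.dist_comm] at h2
    omega
  obtain ⟨D', hD', hEq⟩ := exists_derivable_along_path (G := G) (D := D) p.getVert n
    (fun i hi => p.adj_getVert_succ (by omega))
    (hp.getVert_injOn.mono fun i hi => by simp only [Set.mem_Iic] at hi; simp; omega)
    (by have := hW f; rw [hx0]; omega) hinner
  have hval : stdVal G {q | W q < D q} D' = stdVal G {q | W q < D q} D := by
    have h := congrArg (stdVal G {q | W q < D q}) hEq
    rw [stdVal_add, stdVal_add, stdVal_add, stdVal_sum] at h
    simp only [stdVal_single] at h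
    rw [hdist 0 (by omega), hdist (n + 1) le_rfl, Finset.sum_congr rfl fun i hi => by
      rw [hdist (i + 1) (by have := Finset.mem_range.1 hi; omega)]] at h
    have hgeom : 2 + ∑ i ∈ Finset.range n, 2 ^ (i + 1) = 2 ^ (n + 1) := by
      clear * -
      induction n with
      | zero => simp
      | succ n ih => rw [Finset.sum_range_succ, ← add_assoc, ih]; ring
    simp only [one_mul, pow_zero, mul_one] at h
    omega
  have hsum : ∑ v, D' v < ∑ v, D v := by
    have h := congrArg (fun E : V → ℕ => ∑ v, E v) hEq
    simp only [Pi.add_apply, Finset.sum_add_distrib, Finset.sum_pi_single', Finset.mem_univ,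
      if_true] at h
    omega
  refine ⟨f, D', hD', hf, hsum, hval, fun v hv => ?_, fun v hvf hv => ?_⟩
  · by_contra! h
    have h1 := congrFun hEq v
    rw [hxn] at h1
    by_cases hvt : v = t
    · subst hvt
      simp at h1
      omega
    · simp [hvt] at h1
      omega
  · have h1 := congrFun hEq v
    have hne' : ∀ i ≤ n, v ≠ p.getVert (i + 1) := fun i hi h => by
      have := hnot_node i hi
      rw [← h] at this
      omega
    have hs : ∑ i ∈ Finset.range n,
        (Pi.single (p.getVert (i + 1)) 1 : V → ℕ) v = 0 :=
      Finset.sum_eq_zero fun i hi =>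
        Pi.single_eq_of_ne (hne' _ (by have := Finset.mem_range.1 hi; omega)) _
    simp only [Pi.add_apply, Finset.sum_apply, hs, hx0, Pi.single_eq_of_ne hvf,
      Pi.single_eq_of_ne (hne' n le_rfl)] at h1
    omega

/-- Theorem 5 of the paper: if the set N of distribution nodes of D relative to W
is nonempty and V_N(D) ≥ max_{d ∈ N} V_{d}(W), then D covers W. -/
theorem covers_of_stdVal_nodes {V : Type*} [Fintype V] (G : SimpleGraph V)
    (hG : G.Connected) (W : V → ℕ) (hW : ∀ q : V, 0 < W q) (D : V → ℕ)
    (hN : {q : V | W q < D q}.Nonempty)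
    (hval : ∀ d : V, W d < D d → stdVal G {d} W ≤ stdVal G {q : V | W q < D q} D) :
    Covers G D W := by
  induction hk : ∑ v, D v using Nat.strong_induction_on generalizing D with
  | _ k ih =>
  by_cases hthin : ∃ t, D t < W t
  · obtain ⟨f, D', hD', hf, hsum, heq, hsub, hkeep⟩ := exists_derivable_stdVal_eq hG hW hN hthin
    by_cases hN' : {q : V | W q < D' q}.Nonempty
    · obtain ⟨E, hE, hWE⟩ := ih _ (hk ▸ hsum) D' hN' (fun d hd =>
        ((hval d (hsub d hd)).trans_eq heq.symm).trans (stdVal_mono_of_subset G hN' hsub D')) rfl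
      exact ⟨E, Relation.ReflTransGen.trans hD' hE, hWE⟩
    · have hle : D' ≤ W := fun v => not_lt.1 fun h => hN' ⟨v, h⟩
      have hset : {q : V | W q < D q} = {f} :=
        Set.eq_singleton_iff_unique_mem.2
          ⟨hf, fun v hv => by_contra fun hvf => hN' ⟨v, hkeep v hvf hv⟩⟩
      have h := hval f hf
      rw [← heq, hset] at h
      exact ⟨D', hD', fun v => (congrFun (eq_of_le_of_stdVal_le G {f} hle h) v).ge⟩
  · push Not at hthin
    exact ⟨D, Relation.ReflTransGen.refl, hthin⟩
end

section
/- Let G be a finite connected simple graph and let W be a positive weight function on G (W(q) > 0 for every vertex q). Then every distribution D on G with total number of pebbles |D| = Σ_{q ∈ V(G)} D(q) ≥ SN_W(G) covers W, where SN_W(G) = max_{v ∈ V(G)} Σ_{u ∈ V(G)} W(u) · 2^{d(u,v)} is the stacking number of G relative to W. -/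
/-- A legal move along an edge changes every weighted pebble count in the expected way. -/
theorem exists_pebblingMove {V : Type*} [Fintype V] {G : SimpleGraph V} {D : V → ℕ} {p q : V}
    (hpq : G.Adj p q) (hp : 2 ≤ D p) :
    ∃ D' : V → ℕ, PebblingMove G D D' ∧ D' p + 2 = D p ∧ D' q = D q + 1 ∧
      (∀ s, s ≠ p → s ≠ q → D' s = D s) ∧
      ∀ w : V → ℕ, ∑ u, D' u * w u + 2 * w p = ∑ u, D u * w u + w q := by
  classical
  have hne : p ≠ q := hpq.ne
  let D' : V → ℕ := fun u => if u = p then D p - 2 else if u = q then D q + 1 else D u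
  have h1 : D' p = D p - 2 := by simp [D']
  have h2 : D' q = D q + 1 := by simp [D', hne.symm]
  have h3 : ∀ s, s ≠ p → s ≠ q → D' s = D s := fun s hs hs' => by simp [D', hs, hs']
  refine ⟨D', ⟨p, q, hpq, hp, h1, h2, h3⟩, by omega, h2, h3, fun w => ?_⟩
  have e1 : 2 * w p = ∑ u, if u = p then 2 * w u else 0 := by simp
  have e2 : w q = ∑ u, if u = q then w u else 0 := by simp
  rw [e1, e2, ← Finset.sum_add_distrib, ← Finset.sum_add_distrib]
  refine Finset.sum_congr rfl fun u _ => ?_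
  by_cases hup : u = p
  · subst hup
    rw [if_pos rfl, if_neg hne, h1, ← add_mul, Nat.sub_add_cancel hp, add_zero]
  · by_cases huq : u = q
    · subst huq
      rw [if_neg hup, if_pos rfl, h2]
      ring
    · rw [if_neg hup, if_neg huq, h3 u hup huq]

/-- If `m` grows by one at each step of the geodesics from `x` to `t`, and their interior vertices
are occupied, then a pebble can be pushed from `x` to `t` while using one of the pebbles already
present at each intermediate vertex. This does not lower the value `∑ D(u) · 2 ^ m(u)`. -/
theorem exists_derivable_push {V : Type*} [Fintype V] {G : SimpleGraph V} (hG : G.Connected)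
    {m : V → ℕ} (hm : ∀ x y, G.Adj x y → m y ≤ m x + 1) (t : V) (k : ℕ) (x : V) (D : V → ℕ)
    (hxt : G.dist x t = k + 1) (hmx : m x + (k + 1) = m t) (hx : 2 ≤ D x)
    (hocc : ∀ y, 0 < G.dist y t → G.dist y t < k + 1 → m y + G.dist y t = m t → 1 ≤ D y) :
    ∃ D' : V → ℕ, Derivable G D D' ∧ D' x < D x ∧ (∀ y, y ≠ t → D' y ≤ D y) ∧
      D' t ≤ D t + 1 ∧ ∑ u, D' u < ∑ u, D u ∧
      ∑ u, D u * 2 ^ m u ≤ ∑ u, D' u * 2 ^ m u := by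
  induction k generalizing x D with
  | zero =>
    have hadj : G.Adj x t := SimpleGraph.dist_eq_one_iff_adj.mp hxt
    obtain ⟨D', hmove, h1, h2, h3, hw⟩ := exists_pebblingMove hadj hx
    have hsum := hw fun _ => 1
    have hval := hw fun u => 2 ^ m u
    simp only [mul_one] at hsum
    have hpow : 2 ^ m t = 2 * 2 ^ m x := by rw [← hmx, zero_add, pow_succ']
    refine ⟨D', .single hmove, by omega, fun y hy => ?_, h2.le, by omega, by omega⟩
    by_cases hyx : y = x
    · subst hyx
      omega
    · exact (h3 y hyx hy).le
  | succ k ih =>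
    obtain ⟨p, hp⟩ := hG.exists_walk_length_eq_dist x t
    cases p with
    | nil => simp at hxt
    | @cons _ z _ hadj p =>
      rw [SimpleGraph.Walk.length_cons, hxt] at hp
      have hle : G.dist z t ≤ k + 1 := (SimpleGraph.dist_le p).trans (by omega)
      have hge : G.dist x t ≤ G.dist x z + G.dist z t := hG.dist_triangle
      rw [SimpleGraph.dist_eq_one_iff_adj.mpr hadj] at hge
      have hzt : G.dist z t = k + 1 := by omega
      have hlip : ∀ n y, G.dist y t = n → m t ≤ m y + n := by
        intro n
        induction n with
        | zero =>
          intro y hy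
          rw [hG.dist_eq_zero_iff.mp hy, add_zero]
        | succ n ihn =>
          intro y hy
          obtain ⟨r, hr⟩ := hG.exists_walk_length_eq_dist y t
          cases r with
          | nil => simp at hy
          | @cons _ y' _ hyy' r =>
            rw [SimpleGraph.Walk.length_cons, hy] at hr
            have h1 : G.dist y' t ≤ n := (SimpleGraph.dist_le r).trans (by omega)
            have h2 : G.dist y t ≤ G.dist y y' + G.dist y' t := hG.dist_triangle
            rw [SimpleGraph.dist_eq_one_iff_adj.mpr hyy'] at h2
            have := ihn y' (by omega)
            have := hm y y' hyy'
            omega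
      have hmz : m z = m x + 1 := by
        have := hm x z hadj
        have := hlip _ z hzt
        omega
      obtain ⟨D₁, hmove, h1, h2, h3, hw⟩ := exists_pebblingMove hadj hx
      have hsum := hw fun _ => 1
      have hval := hw fun u => 2 ^ m u
      simp only [mul_one] at hsum
      have hpow : 2 ^ m z = 2 * 2 ^ m x := by rw [hmz, pow_succ']
      have hz : 1 ≤ D z := hocc z (by omega) (by omega) (by omega)
      obtain ⟨D', hder, h1', h2', h3', hsum', hval'⟩ := ih z D₁ hzt (by omega) (by omega) (by
        intro y hy hyk hmy
        have hyx : y ≠ x := by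
          rintro rfl
          omega
        have hyz : y ≠ z := by
          rintro rfl
          omega
        rw [h3 y hyx hyz]
        exact hocc y hy (by omega) hmy)
      have hxne : x ≠ t := by
        rintro rfl
        simp at hxt
      have hzne : z ≠ t := by
        rintro rfl
        simp at hzt
      have hx' := h2' x hxne
      have ht := h3 t hxne.symm hzne.symm
      refine ⟨D', .head hmove hder, by omega, fun y hy => ?_, by omega, by omega, by omega⟩
      by_cases hyx : y = x
      · subst hyx
        omega
      · by_cases hyz : y = z
        · subst hyz
          omega
        · exact (h2' y hy).trans (h3 y hyx hyz).le

/-- Generalization of the stacking theorem suited to induction: pebbles at `u` are valued at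
`2 ^ m(u)`, where `m(u)` is at most the distance from `u` to `v` and to every vertex carrying
more pebbles than required. -/
theorem covers_of_SN_le_value {V : Type*} [Fintype V] (G : SimpleGraph V)
    (hG : G.Connected) (W : V → ℕ) (hW : ∀ q : V, 0 < W q) (D m : V → ℕ) (v : V)
    (hv : ∀ u, m u ≤ G.dist u v) (hm : ∀ g, W g < D g → ∀ u, m u ≤ G.dist u g)
    (hD : SN G W ≤ ∑ u, D u * 2 ^ m u) : Covers G D W := by
  classical
  induction hN : ∑ u, D u using Nat.strong_induction_on generalizing D m v with
  | _ N ih =>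
  by_cases hthin : ∀ q, W q ≤ D q
  · exact ⟨D, .refl, hthin⟩
  push Not at hthin
  by_cases hfat : ∃ g, W g < D g
  · have hnear : ∀ u, ∃ g, W g < D g ∧ ∀ g', W g' < D g' → G.dist u g ≤ G.dist u g' := by
      intro u
      obtain ⟨g, hg, hmin⟩ := Finset.exists_min_image
        (Finset.univ.filter fun g => W g < D g) (G.dist u) (by simpa [Finset.Nonempty] using hfat)
      exact ⟨g, by simpa using hg, fun g' hg' => hmin g' (by simpa using hg')⟩
    choose near hnf hnmin using hnear
    obtain ⟨t, ht, htmin⟩ := Finset.exists_min_image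
      (Finset.univ.filter fun q => D q < W q) (fun q => G.dist q (near q))
      (by simpa [Finset.Nonempty] using hthin)
    simp only [Finset.mem_filter, Finset.mem_univ, true_and] at ht htmin
    let δ : V → ℕ := fun u => G.dist u (near u)
    have hδ : ∀ x y, G.Adj x y → δ y ≤ δ x + 1 := by
      intro x y hxy
      have h1 : δ y ≤ G.dist y (near x) := hnmin y _ (hnf x)
      have h2 : G.dist y (near x) ≤ G.dist y x + G.dist x (near x) := hG.dist_triangle
      rw [SimpleGraph.dist_eq_one_iff_adj.mpr hxy.symm] at h2
      change δ y ≤ G.dist x (near x) + 1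
      omega
    have hf := hnf t
    have hft : near t ≠ t := by
      intro h
      rw [h] at hf
      omega
    have hpos : 0 < G.dist (near t) t := hG.pos_dist_of_ne hft
    have hδf : δ (near t) = 0 := by
      have := hnmin (near t) _ hf
      simpa [δ] using this
    have hδt : δ t = G.dist (near t) t := SimpleGraph.dist_comm
    have hWf := hW (near t)
    obtain ⟨D', hder, -, hle, hlet, hsum, hval⟩ := exists_derivable_push hG hδ t
      (G.dist (near t) t - 1) (near t) D (by omega) (by omega) (by omega) (by
        intro y hy _ hmy
        by_contra hcon
        have hWy := hW y
        have h : δ t ≤ δ y := htmin y (by omega)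
        omega)
    have hfat' : ∀ g, W g < D' g → W g < D g := by
      intro g hg
      by_cases hgt : g = t
      · subst hgt
        omega
      · exact hg.trans_le (hle g hgt)
    have hmono : ∑ u, D u * 2 ^ m u ≤ ∑ u, D u * 2 ^ δ u :=
      Finset.sum_le_sum fun u _ =>
        Nat.mul_le_mul_left _ (Nat.pow_le_pow_right two_pos (hm _ (hnf u) u))
    obtain ⟨D'', hder', hcov⟩ := ih _ (hN ▸ hsum) D' δ (near t)
      (fun u => hnmin u _ hf) (fun g hg u => hnmin u g (hfat' g hg))
      (hD.trans (hmono.trans hval)) rfl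
    exact ⟨D'', hder.trans hder', hcov⟩
  · push Not at hfat
    obtain ⟨t, ht⟩ := hthin
    have h1 : ∑ u, D u * 2 ^ m u < ∑ u, W u * 2 ^ G.dist u v := by
      refine Finset.sum_lt_sum (fun u _ => ?_) ⟨t, Finset.mem_univ t, ?_⟩
      · exact Nat.mul_le_mul (hfat u) (Nat.pow_le_pow_right two_pos (hv u))
      · exact (Nat.mul_le_mul_left _ (Nat.pow_le_pow_right two_pos (hv t))).trans_lt
          (Nat.mul_lt_mul_of_pos_right ht (by positivity))
    have h2 : ∑ u, W u * 2 ^ G.dist u v ≤ SN G W :=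
      Finset.le_sup (f := fun v : V => ∑ u, W u * 2 ^ G.dist u v) (Finset.mem_univ v)
    omega

/-- Stacking theorem (sufficiency): every distribution with at least SN_W(G)
pebbles covers W. -/
theorem covers_of_SN_le {V : Type*} [Fintype V] (G : SimpleGraph V)
    (hG : G.Connected) (W : V → ℕ) (hW : ∀ q : V, 0 < W q) (D : V → ℕ)
    (hD : SN G W ≤ ∑ q : V, D q) :
    Covers G D W := by
  obtain ⟨v⟩ := hG.nonempty
  exact covers_of_SN_le_value G hG W hW D (fun _ => 0) v (fun _ => Nat.zero_le _)
    (fun _ _ _ => Nat.zero_le _) (by simpa using hD)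
end

section
/- Let G and H be finite connected simple graphs, and let W1 and W2 be positive weight functions on G and H respectively (strictly positive at every vertex). Then Φ_{W1 × W2}(G □ H) = Φ_{W1}(G) · Φ_{W2}(H), where W1 × W2 is the weight function on the Cartesian (box) product G □ H given by (W1 × W2)(g,h) = W1(g)·W2(h). -/
/-- The weighted cover pebbling number: the least m such that every distribution
with m pebbles in total covers W. -/
noncomputable def Phi {V : Type*} [Fintype V] (G : SimpleGraph V) (W : V → ℕ) : ℕ :=
  sInf {m : ℕ | ∀ D : V → ℕ, (∑ q : V, D q) = m → Covers G D W}

section Stacking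

variable {V : Type*} [Fintype V] {G : SimpleGraph V} {W : V → ℕ}

/-- The value `∑_q D(q) · 2^{d(q,v)}` never increases under pebbling moves. -/
theorem PebblingMove.sum_mul_two_pow_dist_le (hG : G.Connected) (v : V) {D D' : V → ℕ}
    (h : PebblingMove G D D') :
    ∑ u, D' u * 2 ^ G.dist u v ≤ ∑ u, D u * 2 ^ G.dist u v := by
  classical
  obtain ⟨p, q, hpq, h2, hp, hq, hs⟩ := h
  have hne : q ≠ p := hpq.ne'
  have hd : G.dist q v ≤ G.dist p v + 1 := by
    have h₁ := hG.dist_triangle (u := q) (v := p) (w := v)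
    have h₂ := SimpleGraph.dist_eq_one_iff_adj.2 hpq.symm
    omega
  have hpow : 2 ^ G.dist q v ≤ 2 * 2 ^ G.dist p v := by
    rw [← pow_succ']
    exact Nat.pow_le_pow_right two_pos hd
  have hmem : q ∈ Finset.univ.erase p := by simp [hne]
  rw [← Finset.add_sum_erase _ _ (Finset.mem_univ p), ← Finset.add_sum_erase _ _ hmem,
    ← Finset.add_sum_erase Finset.univ (fun u => D u * 2 ^ G.dist u v) (Finset.mem_univ p),
    ← Finset.add_sum_erase (Finset.univ.erase p) (fun u => D u * 2 ^ G.dist u v) hmem]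
  have hrest : ∑ u ∈ (Finset.univ.erase p).erase q, D' u * 2 ^ G.dist u v =
      ∑ u ∈ (Finset.univ.erase p).erase q, D u * 2 ^ G.dist u v := by
    refine Finset.sum_congr rfl fun u hu => ?_
    simp only [Finset.mem_erase, Finset.mem_univ, and_true] at hu
    rw [hs u hu.2 hu.1]
  obtain ⟨k, hk⟩ := Nat.exists_eq_add_of_le h2
  rw [hrest, hp, hq, hk, Nat.add_sub_cancel_left]
  nlinarith

theorem Covers.sum_mul_two_pow_dist_le (hG : G.Connected) (v : V) {D : V → ℕ}
    (h : Covers G D W) :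
    ∑ u, W u * 2 ^ G.dist u v ≤ ∑ u, D u * 2 ^ G.dist u v := by
  obtain ⟨D', hD', hW⟩ := h
  have hle : ∑ u, D' u * 2 ^ G.dist u v ≤ ∑ u, D u * 2 ^ G.dist u v := by
    induction hD' using Relation.ReflTransGen.head_induction_on with
    | refl => exact le_rfl
    | head h _ ih => exact ih.trans (h.sum_mul_two_pow_dist_le hG v)
  exact (Finset.sum_le_sum fun u _ => Nat.mul_le_mul_right _ (hW u)).trans hle

/-- Push one extra pebble along a walk on which the potential `e` increases by one in each step,
using up one further pebble at each vertex of the walk. -/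
theorem exists_derivable_of_walk [DecidableEq V] (e : V → ℕ)
    (he : ∀ a b, G.Adj a b → e b ≤ e a + 1) {f t : V} (w : G.Walk f t) :
    ∀ C : V → ℕ, e t = e f + w.length → (∀ v, e f ≤ e v → e v < e t → 1 ≤ C v) →
      ∃ D, Derivable G (C + Pi.single f 1) D ∧ D ≤ C + Pi.single t 1 ∧
        ∑ v, D v + w.length = ∑ v, (C + Pi.single f 1 : V → ℕ) v ∧
        ∑ v, D v * 2 ^ e v = ∑ v, (C + Pi.single f 1 : V → ℕ) v * 2 ^ e v := by
  have hlen : ∀ {a b : V} (w : G.Walk a b), e b ≤ e a + w.length := by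
    intro a b w
    induction w with
    | nil => simp
    | cons h w ih =>
      have := he _ _ h
      simp only [SimpleGraph.Walk.length_cons]
      omega
  induction w with
  | nil => exact fun C _ _ => ⟨_, Relation.ReflTransGen.refl, le_rfl, by simp, rfl⟩
  | @cons f p t h w ih =>
    intro C het hC
    simp only [SimpleGraph.Walk.length_cons] at het
    have hp : e p = e f + 1 := by
      have := he _ _ h
      have := hlen w
      omega
    have hf : 1 ≤ C f := hC f le_rfl (by omega)
    obtain ⟨B, rfl⟩ : ∃ B : V → ℕ, C = B + Pi.single f 1 := by
      refine ⟨C - Pi.single f 1, ?_⟩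
      ext v
      by_cases hv : v = f
      · subst hv
        simp [hf]
      · simp [hv]
    obtain ⟨D, hD, hle, hsum, hval⟩ := ih B (by omega) fun v hv hvt => by
      have hvf : v ≠ f := by
        rintro rfl
        omega
      simpa [hvf] using hC v (by omega) hvt
    have hne : f ≠ p := h.ne
    refine ⟨D, Relation.ReflTransGen.head ⟨f, p, h, ?_, ?_, ?_, ?_⟩ hD, hle.trans ?_, ?_, ?_⟩
    · simp
    · simp [hne]
    · simp [hne.symm]
    · intro s hsf hsp
      simp [hsf, hsp]
    · intro v
      simp
    · simp only [Pi.add_apply, Finset.sum_add_distrib, Finset.sum_pi_single', Finset.mem_univ,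
        if_true, SimpleGraph.Walk.length_cons] at hsum ⊢
      omega
    · simp only [Pi.add_apply, add_mul, Finset.sum_add_distrib, Pi.single_apply, ite_mul, zero_mul,
        one_mul, Finset.sum_ite_eq', Finset.mem_univ, if_true, hp, pow_succ] at hval ⊢
      omega

theorem sum_mul_two_pow_dist_le_SN (G : SimpleGraph V) (W : V → ℕ) (v : V) :
    ∑ u, W u * 2 ^ G.dist u v ≤ SN G W :=
  Finset.le_sup (f := fun v => ∑ u, W u * 2 ^ G.dist u v) (Finset.mem_univ v)

theorem covers_of_le_of_SN_le {D : V → ℕ} (hDW : ∀ v, D v ≤ W v) (e : V → ℕ) (f : V)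
    (he : ∀ v, e v ≤ G.dist v f) (h : SN G W ≤ ∑ v, D v * 2 ^ e v) : Covers G D W := by
  refine ⟨D, Relation.ReflTransGen.refl, ?_⟩
  have h₁ : ∑ v, W v * 2 ^ e v ≤ ∑ v, D v * 2 ^ e v :=
    (Finset.sum_le_sum fun v _ =>
      Nat.mul_le_mul_left _ (Nat.pow_le_pow_right two_pos (he v))).trans
      ((sum_mul_two_pow_dist_le_SN G W f).trans h)
  have h₂ : ∀ v ∈ Finset.univ, D v * 2 ^ e v ≤ W v * 2 ^ e v :=
    fun v _ => Nat.mul_le_mul_right _ (hDW v)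
  have h₃ := (Finset.sum_eq_sum_iff_of_le h₂).1 (le_antisymm (Finset.sum_le_sum h₂) h₁)
  exact fun v => (Nat.eq_of_mul_eq_mul_right (by positivity) (h₃ v (Finset.mem_univ v))).ge

/-- If the value of `D`, weighted by distance to the set of vertices where `D` exceeds the positive
weight `W`, is at least the stacking number, then `D` covers `W`. -/
theorem covers_of_SN_le_sum_inf' (hG : G.Connected) (hW : ∀ v, 0 < W v) (D : V → ℕ)
    (hF : (Finset.univ.filter fun v => W v < D v).Nonempty)
    (h : SN G W ≤ ∑ v, D v * 2 ^ (Finset.univ.filter fun v => W v < D v).inf' hF (G.dist v)) :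
    Covers G D W := by
  classical
  induction hn : ∑ v, D v using Nat.strong_induction_on generalizing D with
  | _ n ih =>
  subst hn
  set F := Finset.univ.filter fun v => W v < D v with hFdef
  set e : V → ℕ := fun v => F.inf' hF (G.dist v)
  have he_le : ∀ f ∈ F, ∀ v, e v ≤ G.dist v f := fun f hf v => Finset.inf'_le (G.dist v) hf
  have he_eq : ∀ v, ∃ f ∈ F, e v = G.dist v f := fun v =>
    Finset.exists_mem_eq_inf' hF (G.dist v)
  have he_lip : ∀ a b, G.Adj a b → e b ≤ e a + 1 := by
    intro a b hab
    obtain ⟨f, hf, hfe⟩ := he_eq a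
    have h₁ := he_le f hf b
    have h₂ := hG.dist_triangle (u := b) (v := a) (w := f)
    have h₃ := SimpleGraph.dist_eq_one_iff_adj.2 hab.symm
    omega
  have he_zero : ∀ f ∈ F, e f = 0 := fun f hf => by
    have := he_le f hf f
    simpa using this
  by_cases hT : (Finset.univ.filter fun v => D v < W v).Nonempty
  swap
  · refine ⟨D, Relation.ReflTransGen.refl, fun v => ?_⟩
    by_contra hv
    exact hT ⟨v, by simpa using hv⟩
  obtain ⟨t, ht, htmin⟩ := Finset.exists_min_image _ e hT
  simp only [Finset.mem_filter, Finset.mem_univ, true_and] at ht htmin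
  obtain ⟨f, hf, hft⟩ := he_eq t
  have hfW : W f < D f := by simpa [hFdef] using hf
  obtain ⟨w, hw⟩ := hG.exists_walk_length_eq_dist f t
  have hne : f ≠ t := by
    rintro rfl
    omega
  have hpos : 0 < G.dist f t := hG.pos_dist_of_ne hne
  obtain ⟨C, hC⟩ : ∃ C : V → ℕ, D = C + Pi.single f 1 := by
    refine ⟨D - Pi.single f 1, ?_⟩
    ext v
    by_cases hv : v = f
    · subst hv
      have : 1 ≤ D v := by omega
      simp [this]
    · simp [hv]
  obtain ⟨D₁, hder, hle, hsum, hval⟩ := exists_derivable_of_walk e he_lip w C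
    (by rw [he_zero f hf, hw, hft, G.dist_comm]; simp) (by
      intro v _ hvt
      have hDv : W v ≤ D v := by
        by_contra hv
        have := htmin v (by omega)
        omega
      have := hW v
      rw [hC] at hDv hfW
      by_cases hv : v = f
      · subst hv
        simp at hfW
        omega
      · simp [hv] at hDv
        omega)
  rw [← hC] at hder hsum hval
  have hsub : ∀ v, W v < D₁ v → W v < D v := by
    intro v hv
    have h₁ := hle v
    by_cases hvt : v = t
    · subst hvt
      have h₂ : C v ≤ D v := by simp [hC]
      simp at h₁
      omega
    · have h₂ : C v ≤ D v := by simp [hC]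
      simp [hvt] at h₁
      omega
  suffices hcov : Covers G D₁ W by
    obtain ⟨D', hD', hWD'⟩ := hcov
    exact ⟨D', hder.trans hD', hWD'⟩
  rw [← hval] at h
  by_cases hF₁ : (Finset.univ.filter fun v => W v < D₁ v).Nonempty
  · refine ih _ (by omega) D₁ hF₁ (h.trans ?_) rfl
    refine Finset.sum_le_sum fun v _ => Nat.mul_le_mul_left _ (Nat.pow_le_pow_right two_pos ?_)
    exact Finset.inf'_mono _ (fun u hu => by simpa [hFdef] using hsub u (by simpa using hu)) hF₁
  · refine covers_of_le_of_SN_le (fun v => ?_) e f (he_le f hf) h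
    by_contra hv
    exact hF₁ ⟨v, by simpa using hv⟩

/-- The cover pebbling theorem: for positive weights, stacked distributions are the worst. -/
theorem Phi_eq_SN (hG : G.Connected) (hW : ∀ v, 0 < W v) : Phi G W = SN G W := by
  classical
  obtain ⟨v₀⟩ := hG.nonempty
  refine IsLeast.csInf_eq ⟨fun D hD => ?_, fun m hm => Finset.sup_le fun v _ => ?_⟩
  · by_cases hF : (Finset.univ.filter fun v => W v < D v).Nonempty
    · refine covers_of_SN_le_sum_inf' hG hW D hF ?_
      rw [← hD]
      exact Finset.sum_le_sum fun v _ => Nat.le_mul_of_pos_right _ (by positivity)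
    · refine covers_of_le_of_SN_le (fun v => ?_) 0 v₀ (fun v => Nat.zero_le _) (by simp [hD])
      by_contra hv
      exact hF ⟨v, by simpa using hv⟩
  · have := (hm (Pi.single v m) (by simp)).sum_mul_two_pow_dist_le hG v
    simpa [Pi.single_apply] using this

end Stacking

theorem SN_boxProd {α β : Type*} [Fintype α] [Fintype β]
    (G : SimpleGraph α) (H : SimpleGraph β) (hG : G.Connected) (hH : H.Connected)
    (W1 : α → ℕ) (W2 : β → ℕ) :
    SN (G □ H) (fun p : α × β => W1 p.1 * W2 p.2) = SN G W1 * SN H W2 := by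
  have key : ∀ v : α × β, ∑ u : α × β, W1 u.1 * W2 u.2 * 2 ^ (G □ H).dist u v =
      (∑ a, W1 a * 2 ^ G.dist a v.1) * ∑ b, W2 b * 2 ^ H.dist b v.2 := by
    intro v
    rw [Finset.sum_mul_sum, Fintype.sum_prod_type]
    refine Finset.sum_congr rfl fun a _ => Finset.sum_congr rfl fun b _ => ?_
    have hd : (G □ H).dist (a, b) v = G.dist a v.1 + H.dist b v.2 := by
      rw [SimpleGraph.dist, SimpleGraph.edist_boxProd,
        ENat.toNat_add (SimpleGraph.edist_ne_top_iff_reachable.2 (hG _ _))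
          (SimpleGraph.edist_ne_top_iff_reachable.2 (hH _ _))]
      rfl
    rw [hd, pow_add]
    ring
  obtain ⟨a₀⟩ := hG.nonempty
  obtain ⟨b₀⟩ := hH.nonempty
  refine le_antisymm (Finset.sup_le fun v _ => ?_) ?_
  · rw [key]
    exact Nat.mul_le_mul (sum_mul_two_pow_dist_le_SN G W1 v.1)
      (sum_mul_two_pow_dist_le_SN H W2 v.2)
  · obtain ⟨a, _, ha⟩ := Finset.exists_mem_eq_sup Finset.univ ⟨a₀, Finset.mem_univ _⟩
      fun v => ∑ u, W1 u * 2 ^ G.dist u v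
    obtain ⟨b, _, hb⟩ := Finset.exists_mem_eq_sup Finset.univ ⟨b₀, Finset.mem_univ _⟩
      fun v => ∑ u, W2 u * 2 ^ H.dist u v
    rw [SN, SN, ha, hb, ← key (a, b)]
    exact sum_mul_two_pow_dist_le_SN (G □ H) (fun p : α × β => W1 p.1 * W2 p.2) (a, b)

/-- Graham-type product theorem for weighted cover pebbling. -/
theorem Phi_boxProd {α β : Type*} [Fintype α] [Fintype β]
    (G : SimpleGraph α) (H : SimpleGraph β) (hG : G.Connected) (hH : H.Connected)
    (W1 : α → ℕ) (W2 : β → ℕ) (hW1 : ∀ g : α, 0 < W1 g) (hW2 : ∀ h : β, 0 < W2 h) :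
    Phi (G □ H) (fun p : α × β => W1 p.1 * W2 p.2) = Phi G W1 * Phi H W2 := by
  rw [Phi_eq_SN hG hW1, Phi_eq_SN hH hW2,
    Phi_eq_SN (hG.boxProd hH) fun p => Nat.mul_pos (hW1 p.1) (hW2 p.2),
    SN_boxProd G H hG hH]
end
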